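/- Suppose f : ℝ^l × ℝ^p → L(ℝ^l, ℝ^p) is real-analytic. Then for every r ≥ 1 the full jet-lifting map ℝ^l × ℝ^p × (ℝ^l)^r → (ℝ^p)^r, (x₀, y₀, a) ↦ J_{x₀,y₀,r}(a), is real-analytic (jointly in the basepoint (x₀, y₀) and the jet coefficients a). -/

import Mathlib

/-- The polynomial curve `t ↦ c₀ + ∑_{j=1}^r c_j t^j` in `ℝ^d`
(indexing: `c j` is the coefficient of `t^(j+1)` for `j : Fin r`). -/
noncomputable def polyCurve {d : ℕ} (c₀ : Fin d → ℝ) {r : ℕ} (c : Fin r → (Fin d → ℝ)) :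
    ℝ → (Fin d → ℝ) :=
  fun t => c₀ + ∑ j : Fin r, t ^ ((j : ℕ) + 1) • c j

/-- `IsJetLift f x₀ y₀ r a b` : setting `x t = x₀ + ∑ a_j t^j` and `y t = y₀ + ∑ b_j t^j`,
the defect `g t = y′ t − f (x t, y t) (x′ t)` vanishes to order `r` at `t = 0`. -/
def IsJetLift {l p : ℕ}
    (f : (Fin l → ℝ) × (Fin p → ℝ) → ((Fin l → ℝ) →L[ℝ] (Fin p → ℝ)))
    (x₀ : Fin l → ℝ) (y₀ : Fin p → ℝ) (r : ℕ)
    (a : Fin r → (Fin l → ℝ)) (b : Fin r → (Fin p → ℝ)) : Prop :=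
  ∀ j < r,
    iteratedDeriv j
      (fun t : ℝ =>
        deriv (polyCurve y₀ b) t
          - f (polyCurve x₀ a t, polyCurve y₀ b t) (deriv (polyCurve x₀ a) t)) 0 = 0

open scoped ContDiff

section

variable {E F W : Type*} [NormedAddCommGroup E] [NormedSpace ℝ E]
  [NormedAddCommGroup F] [NormedSpace ℝ F] [NormedAddCommGroup W] [NormedSpace ℝ W]

theorem analyticAt_clm_apply {u : W → E →L[ℝ] F} {v : W → E} {w : W}
    (hu : AnalyticAt ℝ u w) (hv : AnalyticAt ℝ v w) : AnalyticAt ℝ (fun w => u w (v w)) w :=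
  ((ContinuousLinearMap.id ℝ (E →L[ℝ] F)).analyticAt_bilinear (u w, v w)).comp₂ hu hv

/-- The partial derivative in the last variable of a jointly analytic map is jointly analytic. -/
theorem analyticAt_deriv_right [CompleteSpace F] {G : W × ℝ → F}
    (hG : ∀ z, AnalyticAt ℝ G z) (z : W × ℝ) :
    AnalyticAt ℝ (fun z : W × ℝ => deriv (fun t => G (z.1, t)) z.2) z := by
  have h : (fun z : W × ℝ => deriv (fun t => G (z.1, t)) z.2)
      = fun z => fderiv ℝ G z ((0 : W), (1 : ℝ)) := by
    funext z
    have h₁ : HasDerivAt (fun t : ℝ => (z.1, t)) ((0 : W), (1 : ℝ)) z.2 :=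
      (hasDerivAt_const z.2 z.1).prodMk (hasDerivAt_id z.2)
    exact ((hG z).differentiableAt.hasFDerivAt.comp_hasDerivAt z.2 h₁).deriv
  rw [h]
  exact analyticAt_clm_apply (hG z).fderiv analyticAt_const

/-- The iterated partial derivatives in the last variable of a jointly analytic map are
jointly analytic. -/
theorem analyticAt_iteratedDeriv_right [CompleteSpace F] (n : ℕ) {G : W × ℝ → F}
    (hG : ∀ z, AnalyticAt ℝ G z) (z : W × ℝ) :
    AnalyticAt ℝ (fun z : W × ℝ => iteratedDeriv n (fun t => G (z.1, t)) z.2) z := by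
  induction n generalizing G z with
  | zero => simpa using hG z
  | succ n ih =>
    simp only [iteratedDeriv_succ']
    exact ih (analyticAt_deriv_right hG) z

theorem iteratedDeriv_prodMk (n : ℕ) {u : ℝ → E} {v : ℝ → F}
    (hu : ContDiff ℝ ∞ u) (hv : ContDiff ℝ ∞ v) (t : ℝ) :
    iteratedDeriv n (fun s => (u s, v s)) t = (iteratedDeriv n u t, iteratedDeriv n v t) := by
  induction n generalizing t with
  | zero => simp
  | succ n ih =>
    simp only [iteratedDeriv_succ, funext ih]
    have hn : (n : WithTop ℕ∞) < ∞ := by exact_mod_cast WithTop.coe_lt_top _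
    exact ((hu.differentiable_iteratedDeriv n hn t).hasDerivAt.prodMk
      (hv.differentiable_iteratedDeriv n hn t).hasDerivAt).deriv

/-- The `n`-th derivative of `φ ∘ c` at a point depends only on the `n`-jet of `c` there. -/
theorem iteratedDeriv_comp_congr_of_jet_eq (n : ℕ) {E F : Type*} [NormedAddCommGroup E]
    [NormedSpace ℝ E] [NormedAddCommGroup F] [NormedSpace ℝ F] {φ : E → F} (hφ : ContDiff ℝ ∞ φ)
    {c d : ℝ → E} (hc : ContDiff ℝ ∞ c) (hd : ContDiff ℝ ∞ d) {t : ℝ}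
    (h : ∀ k ≤ n, iteratedDeriv k c t = iteratedDeriv k d t) :
    iteratedDeriv n (fun s => φ (c s)) t = iteratedDeriv n (fun s => φ (d s)) t := by
  induction n generalizing E with
  | zero => simpa using congrArg φ (by simpa using h 0 le_rfl)
  | succ n ih =>
    have hderiv : ∀ {e : ℝ → E}, ContDiff ℝ ∞ e →
        deriv (fun s => φ (e s)) =
          fun s => (fun q : E × E => fderiv ℝ φ q.1 q.2) (e s, deriv e s) :=
      fun he => funext fun s =>
        ((hφ.differentiable (by simp) _).hasFDerivAt.comp_hasDerivAt s
          (he.differentiable (by simp) s).hasDerivAt).deriv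
    have hψ : ContDiff ℝ ∞ (fun q : E × E => fderiv ℝ φ q.1 q.2) :=
      ((hφ.fderiv_right le_rfl).comp contDiff_fst).clm_apply contDiff_snd
    have hsucc : ∀ {e : ℝ → E}, ContDiff ℝ ∞ e → ContDiff ℝ ∞ (deriv e) :=
      fun he => (contDiff_infty_iff_deriv.1 he).2
    rw [iteratedDeriv_succ', iteratedDeriv_succ', hderiv hc, hderiv hd]
    refine ih hψ (hc.prodMk (hsucc hc)) (hd.prodMk (hsucc hd)) fun k hk => ?_
    rw [iteratedDeriv_prodMk k hc (hsucc hc), iteratedDeriv_prodMk k hd (hsucc hd),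
      ← iteratedDeriv_succ', ← iteratedDeriv_succ', h k (by omega), h (k + 1) (by omega)]

end

theorem analyticAt_polyCurve {d r : ℕ}
    (z : ((Fin d → ℝ) × (Fin r → (Fin d → ℝ))) × ℝ) :
    AnalyticAt ℝ (fun z : ((Fin d → ℝ) × (Fin r → (Fin d → ℝ))) × ℝ =>
      polyCurve z.1.1 z.1.2 z.2) z := by
  refine ContDiffAt.analyticAt (𝕜 := ℝ) ?_
  unfold polyCurve
  fun_prop

theorem contDiff_polyCurve {d r : ℕ} (c₀ : Fin d → ℝ) (c : Fin r → (Fin d → ℝ)) :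
    ContDiff ℝ ∞ (polyCurve c₀ c) := by
  unfold polyCurve
  fun_prop

theorem iteratedDeriv_polyCurve_succ {d r : ℕ} (c₀ : Fin d → ℝ) (c : Fin r → (Fin d → ℝ)) (n : ℕ) :
    iteratedDeriv (n + 1) (polyCurve c₀ c) 0
      = ∑ j : Fin r, (if n = j then ((n + 1).factorial : ℝ) else 0) • c j := by
  unfold polyCurve
  rw [iteratedDeriv_const_add (by omega), iteratedDeriv_fun_sum fun i _ => by fun_prop]
  refine Finset.sum_congr rfl fun j _ => ?_
  rw [iteratedDeriv_smul_const (by fun_prop), iteratedDeriv_fun_pow_zero]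
  by_cases h : n = j <;> simp [h]

theorem iteratedDeriv_polyCurve_congr {d r n : ℕ} (c₀ : Fin d → ℝ)
    {b c : Fin r → (Fin d → ℝ)} (h : ∀ j : Fin r, (j : ℕ) < n → b j = c j) :
    ∀ k ≤ n, iteratedDeriv k (polyCurve c₀ b) 0 = iteratedDeriv k (polyCurve c₀ c) 0
  | 0, _ => by simp [polyCurve]
  | k + 1, hk => by
    rw [iteratedDeriv_polyCurve_succ, iteratedDeriv_polyCurve_succ]
    refine Finset.sum_congr rfl fun j _ => ?_
    split_ifs with hj
    · rw [h j (by omega)]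
    · simp

/-- Basepoints and jet coefficients `(x₀, y₀, a, b)` of a pair of polynomial curves. -/
abbrev JetData (l p r : ℕ) : Type :=
  (Fin l → ℝ) × (Fin p → ℝ) × (Fin r → (Fin l → ℝ)) × (Fin r → (Fin p → ℝ))

/-- The right-hand side of the lifting equation along polynomial curves. -/
noncomputable def liftingField {l p : ℕ}
    (f : (Fin l → ℝ) × (Fin p → ℝ) → ((Fin l → ℝ) →L[ℝ] (Fin p → ℝ))) {r : ℕ}
    (x₀ : Fin l → ℝ) (y₀ : Fin p → ℝ) (a : Fin r → (Fin l → ℝ)) (b : Fin r → (Fin p → ℝ)) :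
    ℝ → (Fin p → ℝ) :=
  fun t => f (polyCurve x₀ a t, polyCurve y₀ b t) (deriv (polyCurve x₀ a) t)

section

variable {l p r : ℕ} {f : (Fin l → ℝ) × (Fin p → ℝ) → ((Fin l → ℝ) →L[ℝ] (Fin p → ℝ))}

theorem contDiff_deriv_polyCurve {d : ℕ} (c₀ : Fin d → ℝ) (c : Fin r → (Fin d → ℝ)) :
    ContDiff ℝ ∞ (deriv (polyCurve c₀ c)) :=
  (contDiff_infty_iff_deriv.1 (contDiff_polyCurve c₀ c)).2

theorem contDiff_liftingField (hf : ContDiff ℝ ∞ f) (x₀ : Fin l → ℝ) (y₀ : Fin p → ℝ)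
    (a : Fin r → (Fin l → ℝ)) (b : Fin r → (Fin p → ℝ)) :
    ContDiff ℝ ∞ (liftingField f x₀ y₀ a b) :=
  (hf.comp ((contDiff_polyCurve x₀ a).prodMk (contDiff_polyCurve y₀ b))).clm_apply
    (contDiff_deriv_polyCurve x₀ a)

/-- The `n`-th derivative of the lifting field at `0` depends only on the coefficients of `y`
of order at most `n`. -/
theorem iteratedDeriv_liftingField_congr (hf : ContDiff ℝ ∞ f) {n : ℕ} (x₀ : Fin l → ℝ)
    (y₀ : Fin p → ℝ) (a : Fin r → (Fin l → ℝ)) {b c : Fin r → (Fin p → ℝ)}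
    (h : ∀ j : Fin r, (j : ℕ) < n → b j = c j) :
    iteratedDeriv n (liftingField f x₀ y₀ a b) 0
      = iteratedDeriv n (liftingField f x₀ y₀ a c) 0 := by
  have hx := contDiff_polyCurve x₀ a
  have hx' := contDiff_deriv_polyCurve x₀ a
  have hy := contDiff_polyCurve (r := r) y₀
  have hφ : ContDiff ℝ ∞
      (fun q : ((Fin l → ℝ) × (Fin p → ℝ)) × (Fin l → ℝ) => f q.1 q.2) :=
    (hf.comp contDiff_fst).clm_apply contDiff_snd
  refine iteratedDeriv_comp_congr_of_jet_eq n hφ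
    (c := fun t => ((polyCurve x₀ a t, polyCurve y₀ b t), deriv (polyCurve x₀ a) t))
    (d := fun t => ((polyCurve x₀ a t, polyCurve y₀ c t), deriv (polyCurve x₀ a) t))
    ((hx.prodMk (hy b)).prodMk hx') ((hx.prodMk (hy c)).prodMk hx') fun k hk => ?_
  rw [iteratedDeriv_prodMk k (hx.prodMk (hy b)) hx', iteratedDeriv_prodMk k (hx.prodMk (hy c)) hx',
    iteratedDeriv_prodMk k hx (hy b), iteratedDeriv_prodMk k hx (hy c),
    iteratedDeriv_polyCurve_congr y₀ h k hk]

/-- The coefficients of a jet lift satisfy a triangular recursion. -/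
theorem IsJetLift.factorial_smul_eq (hf : ContDiff ℝ ∞ f) {x₀ : Fin l → ℝ} {y₀ : Fin p → ℝ}
    {a : Fin r → (Fin l → ℝ)} {b : Fin r → (Fin p → ℝ)} (h : IsJetLift f x₀ y₀ r a b)
    (j : Fin r) :
    (((j : ℕ) + 1).factorial : ℝ) • b j = iteratedDeriv j (liftingField f x₀ y₀ a b) 0 := by
  have hj : iteratedDeriv j
      (fun t => deriv (polyCurve y₀ b) t - liftingField f x₀ y₀ a b t) 0 = 0 := h j j.2
  have hsmooth : ∀ {g : ℝ → Fin p → ℝ}, ContDiff ℝ ∞ g → ContDiffAt ℝ (j : ℕ) g 0 :=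
    fun hg => (hg.of_le (by exact_mod_cast le_top)).contDiffAt
  rw [iteratedDeriv_fun_sub (hsmooth (contDiff_deriv_polyCurve y₀ b))
    (hsmooth (contDiff_liftingField hf x₀ y₀ a b)), sub_eq_zero, ← iteratedDeriv_succ',
    iteratedDeriv_polyCurve_succ] at hj
  simpa [Fin.val_inj] using hj

/-- The derivatives of the lifting field at `0` are analytic in the basepoint and coefficients. -/
theorem analyticAt_iteratedDeriv_liftingField (hf : ∀ z, AnalyticAt ℝ f z) (n : ℕ)
    (w : JetData l p r) :
    AnalyticAt ℝ
      (fun w : JetData l p r =>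
        iteratedDeriv n (liftingField f w.1 w.2.1 w.2.2.1 w.2.2.2) 0) w := by
  have hx : ∀ z : JetData l p r × ℝ,
      AnalyticAt ℝ (fun z : JetData l p r × ℝ => polyCurve z.1.1 z.1.2.2.1 z.2) z :=
    fun z => (analyticAt_polyCurve ((z.1.1, z.1.2.2.1), z.2)).comp
      (f := fun z : JetData l p r × ℝ => ((z.1.1, z.1.2.2.1), z.2))
      (ContDiffAt.analyticAt (by fun_prop))
  have hy : ∀ z : JetData l p r × ℝ,
      AnalyticAt ℝ (fun z : JetData l p r × ℝ => polyCurve z.1.2.1 z.1.2.2.2 z.2) z :=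
    fun z => (analyticAt_polyCurve ((z.1.2.1, z.1.2.2.2), z.2)).comp
      (f := fun z : JetData l p r × ℝ => ((z.1.2.1, z.1.2.2.2), z.2))
      (ContDiffAt.analyticAt (by fun_prop))
  have hG : ∀ z : JetData l p r × ℝ, AnalyticAt ℝ
      (fun z : JetData l p r × ℝ => liftingField f z.1.1 z.1.2.1 z.1.2.2.1 z.1.2.2.2 z.2) z :=
    fun z => analyticAt_clm_apply ((hf _).comp₂ (hx z) (hy z)) (analyticAt_deriv_right hx z)
  exact (analyticAt_iteratedDeriv_right n hG (w, 0)).comp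
    (f := fun w : JetData l p r => (w, (0 : ℝ))) (by fun_prop)

end

/-- If `f : ℝ^l × ℝ^p → L(ℝ^l, ℝ^p)` is real-analytic, then for every `r ≥ 1` the full
jet-lifting map `(x₀, y₀, a) ↦ J_{x₀,y₀,r}(a)` is real-analytic, jointly in the basepoint
`(x₀, y₀)` and the jet coefficients `a`. -/
theorem jet_lift_analytic
    (l p : ℕ) (hl : 1 ≤ l) (hp : 1 ≤ p)
    (f : (Fin l → ℝ) × (Fin p → ℝ) → ((Fin l → ℝ) →L[ℝ] (Fin p → ℝ)))
    (hf : ∀ z, AnalyticAt ℝ f z)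
    (r : ℕ) (hr : 1 ≤ r)
    (J : (Fin l → ℝ) × (Fin p → ℝ) × (Fin r → (Fin l → ℝ)) → (Fin r → (Fin p → ℝ)))
    (hJ : ∀ (x₀ : Fin l → ℝ) (y₀ : Fin p → ℝ) (a : Fin r → (Fin l → ℝ)),
      IsJetLift f x₀ y₀ r a (J (x₀, y₀, a)) ∧
        ∀ b, IsJetLift f x₀ y₀ r a b → b = J (x₀, y₀, a)) :
    ∀ z, AnalyticAt ℝ J z := by
  intro z
  have hsmooth : ContDiff ℝ ∞ f := contDiff_iff_contDiffAt.2 fun q => (hf q).contDiffAt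
  suffices hcoeff : ∀ n, ∀ j : Fin r, (j : ℕ) = n → AnalyticAt ℝ (fun z => J z j) z from
    analyticAt_pi_iff.2 fun j => hcoeff j j rfl
  intro n
  induction n using Nat.strong_induction_on with
  | _ n ih =>
    rintro j rfl
    have hrec : (fun z => J z j) = fun z => (((j : ℕ) + 1).factorial : ℝ)⁻¹ •
        iteratedDeriv j (liftingField f z.1 z.2.1 z.2.2 fun k => if k < j then J z k else 0) 0 := by
      funext z
      rw [eq_inv_smul_iff₀ (by positivity), (hJ z.1 z.2.1 z.2.2).1.factorial_smul_eq hsmooth j]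
      refine iteratedDeriv_liftingField_congr hsmooth _ _ _ fun k hk => ?_
      rw [if_pos (Fin.lt_def.2 hk)]
    have htrunc : AnalyticAt ℝ (fun z => fun k => if k < j then J z k else 0) z := by
      refine analyticAt_pi_iff.2 fun k => ?_
      split_ifs with hk
      · exact ih k hk k rfl
      · exact analyticAt_const
    rw [hrec]
    refine AnalyticAt.fun_const_smul (c := (((j : ℕ) + 1).factorial : ℝ)⁻¹) ?_
    exact (analyticAt_iteratedDeriv_liftingField hf j
      (z.1, z.2.1, z.2.2, fun k => if k < j then J z k else 0)).comp
      (f := fun z => (z.1, z.2.1, z.2.2, fun k => if k < j then J z k else 0))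
      (analyticAt_fst.prod ((analyticAt_fst.comp analyticAt_snd).prod
        ((analyticAt_snd.comp analyticAt_snd).prod htrunc)))
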